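/- In a general Miquel configuration, let D be the circumcenter of A, R, P; let E be the circumcenter of B, P, Q; and let F be the circumcenter of C, Q, R. Then dist(D, E) · dist(B, C) = dist(E, F) · dist(A, B). -/

import Mathlib

theorem Collinear.exists_eq_add_mul_sub {X Y Z : ℂ}
    (h : Collinear ℝ ({X, Y, Z} : Set ℂ)) (hXY : X ≠ Y) :
    ∃ t : ℝ, Z = X + t * (Y - X) := by
  have hZ : Z ∈ line[ℝ, X, Y] :=
    h.mem_affineSpan_of_mem_of_ne (by simp) (by simp) (by simp) hXY
  rw [← sub_add_cancel Z X, ← vadd_eq_add, vadd_left_mem_affineSpan_pair] at hZ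
  obtain ⟨t, ht⟩ := hZ
  refine ⟨t, ?_⟩
  rw [vsub_eq_sub, Complex.real_smul] at ht
  rw [ht, add_sub_cancel]

theorem Complex.cross_ne_zero_of_not_collinear {X Y Z : ℂ}
    (h : ¬ Collinear ℝ ({X, Y, Z} : Set ℂ)) :
    (Y.re - X.re) * (Z.im - X.im) - (Y.im - X.im) * (Z.re - X.re) ≠ 0 := by
  intro h0
  apply h
  by_cases hXY : X = Y
  · subst hXY
    simpa using collinear_pair ℝ X Z
  have hn : (Y.re - X.re) ^ 2 + (Y.im - X.im) ^ 2 ≠ 0 := by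
    intro hn
    apply hXY
    apply Complex.ext <;> nlinarith [sq_nonneg (Y.re - X.re), sq_nonneg (Y.im - X.im)]
  rw [collinear_iff_of_mem (p₀ := X) (by simp)]
  refine ⟨Y - X, ?_⟩
  simp only [Set.mem_insert_iff, Set.mem_singleton_iff, forall_eq_or_imp, forall_eq]
  refine ⟨⟨0, by simp⟩, ⟨1, by simp⟩,
    ((Y.re - X.re) * (Z.re - X.re) + (Y.im - X.im) * (Z.im - X.im)) /
      ((Y.re - X.re) ^ 2 + (Y.im - X.im) ^ 2), ?_⟩
  apply Complex.ext
  · simp only [vadd_eq_add, Complex.add_re, Complex.smul_re, Complex.sub_re, smul_eq_mul]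
    field_simp
    linear_combination (-(Y.im - X.im)) * h0
  · simp only [vadd_eq_add, Complex.add_im, Complex.smul_im, Complex.sub_im, smul_eq_mul]
    field_simp
    linear_combination (Y.re - X.re) * h0

/-- A point equidistant from `X` and `X + t (Y - X)` projects onto the line `XY` at the midpoint
of these two points. -/
theorem Complex.two_mul_dot_sub_of_dist_eq {O X Y Z : ℂ} {t : ℝ}
    (hZ : Z = X + t * (Y - X)) (hZX : Z ≠ X) (h : dist O X = dist O Z) :
    2 * ((O.re - X.re) * (Y.re - X.re) + (O.im - X.im) * (Y.im - X.im)) =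
      t * ((Y.re - X.re) ^ 2 + (Y.im - X.im) ^ 2) := by
  have ht : t ≠ 0 := by
    rintro rfl
    simp [hZ] at hZX
  rw [Complex.dist_eq_re_im, Complex.dist_eq_re_im,
    Real.sqrt_inj (by positivity) (by positivity)] at h
  subst hZ
  simp at h
  apply mul_left_cancel₀ ht
  linear_combination h

theorem Complex.cross_mul_re_im_of_dot {x u v : ℂ} {s t : ℝ}
    (hu : 2 * (x.re * u.re + x.im * u.im) = s) (hv : 2 * (x.re * v.re + x.im * v.im) = t) :
    2 * (u.re * v.im - u.im * v.re) * x.re = s * v.im - t * u.im ∧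
      2 * (u.re * v.im - u.im * v.re) * x.im = t * u.re - s * v.re := by
  subst hu hv
  constructor <;> ring


/-- In a general Miquel configuration, with `D`, `E`, `F` the circumcenters of
`A, R, P`; `B, P, Q`; `C, Q, R` respectively,
`dist D E * dist B C = dist E F * dist A B`. -/
theorem miquel_centres_ratio_DE_EF
    (A B C P Q R : ℂ)
    (hABC : ¬ Collinear ℝ ({A, B, C} : Set ℂ))
    (hP : Collinear ℝ ({A, B, P} : Set ℂ))
    (hQ : Collinear ℝ ({B, C, Q} : Set ℂ))
    (hR : Collinear ℝ ({C, A, R} : Set ℂ))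
    (hPA : P ≠ A) (hPB : P ≠ B) (hPC : P ≠ C)
    (hQA : Q ≠ A) (hQB : Q ≠ B) (hQC : Q ≠ C)
    (hRA : R ≠ A) (hRB : R ≠ B) (hRC : R ≠ C)
    (hARP : ¬ Collinear ℝ ({A, R, P} : Set ℂ))
    (hBPQ : ¬ Collinear ℝ ({B, P, Q} : Set ℂ))
    (hCQR : ¬ Collinear ℝ ({C, Q, R} : Set ℂ))
    (D E F : ℂ)
    (hD : dist D A = dist D R ∧ dist D A = dist D P)
    (hE : dist E B = dist E P ∧ dist E B = dist E Q)
    (hF : dist F C = dist F Q ∧ dist F C = dist F R) :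
    dist D E * dist B C = dist E F * dist A B := by
  have hAB : A ≠ B := by rintro rfl; exact hABC (by simpa using collinear_pair ℝ A C)
  have hBC : B ≠ C := by rintro rfl; exact hABC (by simpa using collinear_pair ℝ A B)
  have hCA : C ≠ A := by
    rintro rfl
    exact hABC (by rw [Set.insert_comm]; simpa using collinear_pair ℝ B C)
  obtain ⟨p, hp⟩ := hP.exists_eq_add_mul_sub hAB
  obtain ⟨q, hq⟩ := hQ.exists_eq_add_mul_sub hBC
  obtain ⟨r, hr⟩ := hR.exists_eq_add_mul_sub hCA
  have hp' : P = B + ((1 - p : ℝ) : ℂ) * (A - B) := by rw [hp]; push_cast; ring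
  have hq' : Q = C + ((1 - q : ℝ) : ℂ) * (B - C) := by rw [hq]; push_cast; ring
  have hr' : R = A + ((1 - r : ℝ) : ℂ) * (C - A) := by rw [hr]; push_cast; ring
  have hΔ := Complex.cross_ne_zero_of_not_collinear hABC
  obtain ⟨d₁, d₂⟩ := Complex.cross_mul_re_im_of_dot (x := D - A) (u := B - A) (v := C - A)
    (Complex.two_mul_dot_sub_of_dist_eq hp hPA hD.2)
    (Complex.two_mul_dot_sub_of_dist_eq hr' hRA hD.1)
  obtain ⟨e₁, e₂⟩ := Complex.cross_mul_re_im_of_dot (x := E - B) (u := C - B) (v := A - B)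
    (Complex.two_mul_dot_sub_of_dist_eq hq hQB hE.2)
    (Complex.two_mul_dot_sub_of_dist_eq hp' hPB hE.1)
  obtain ⟨f₁, f₂⟩ := Complex.cross_mul_re_im_of_dot (x := F - C) (u := A - C) (v := B - C)
    (Complex.two_mul_dot_sub_of_dist_eq hr hRC hF.2)
    (Complex.two_mul_dot_sub_of_dist_eq hq' hQC hF.1)
  simp only [Complex.sub_re, Complex.sub_im] at d₁ d₂ e₁ e₂ f₁ f₂
  have key : (D - E) * (B - C) = (E - F) * (A - B) := by
    apply Complex.ext
    · apply mul_left_cancel₀ (mul_ne_zero two_ne_zero hΔ)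
      simp only [Complex.mul_re, Complex.sub_re, Complex.sub_im]
      linear_combination (B.re - C.re) * d₁ - (B.im - C.im) * d₂
        - (A.re - C.re) * e₁ + (A.im - C.im) * e₂ + (A.re - B.re) * f₁ - (A.im - B.im) * f₂
    · apply mul_left_cancel₀ (mul_ne_zero two_ne_zero hΔ)
      simp only [Complex.mul_im, Complex.sub_re, Complex.sub_im]
      linear_combination (B.im - C.im) * d₁ + (B.re - C.re) * d₂
        - (A.im - C.im) * e₁ - (A.re - C.re) * e₂ + (A.im - B.im) * f₁ + (A.re - B.re) * f₂
  simpa [dist_eq_norm] using congrArg norm key
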